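/- arXiv:2402.02264 — 3 statements merged into one kernel-verified Lean document; each statement's English description precedes it below -/
import Mathlib

section
/- Suppose μ_X/σ_X = μ_Y/σ_Y. Let n ≥ 1 and let W be a real-valued random variable with E|W| < ∞. Suppose that E[A₂f(W)] = 0 for every function f : ℝ → ℝ of class C³ such that E|f^{(m)}(Z̄_n)| < ∞ for m = 0,1,2 and E|Z̄_n·f^{(m)}(Z̄_n)| < ∞ for m = 0,1,2,3 (in particular for all f whose derivatives up to order three are bounded, and for which the left-hand side is defined). Then W has the same distribution as Z̄_n, the mean of n independent PN(μ_X,μ_Y;σ_X²,σ_Y²;ρ) random variables. -/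
open MeasureTheory ProbabilityTheory

/-- The product-normal law `PN(μX, μY; σX², σY²; ρ)`: the law of `X * Y` where
`X = μX + σX * U`, `Y = μY + σY * (ρ * U + √(1 - ρ²) * V)` and `U, V` are independent
standard normal random variables. -/
noncomputable def PN (μX μY σX σY ρ : ℝ) : Measure ℝ :=
  Measure.map
    (fun p : ℝ × ℝ =>
      (μX + σX * p.1) * (μY + σY * (ρ * p.1 + Real.sqrt (1 - ρ ^ 2) * p.2)))
    ((gaussianReal 0 1).prod (gaussianReal 0 1))

/-- The law of the mean `Z̄ₙ = n⁻¹ ∑ᵢ Zᵢ` of `n` independent random variables with law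
`PN(μX, μY; σX², σY²; ρ)`. -/
noncomputable def PNbar (n : ℕ) (μX μY σX σY ρ : ℝ) : Measure ℝ :=
  Measure.map (fun ω : Fin n → ℝ => (∑ i, ω i) / (n : ℝ))
    (Measure.pi fun _ : Fin n => PN μX μY σX σY ρ)

/-- The third-order Stein operator `A₂` (with `s_n = σXσY/n`, `r_X = μX/σX`, `r_Y = μY/σY`). -/
noncomputable def A2 (n : ℕ) (μX μY σX σY ρ : ℝ) (f : ℝ → ℝ) (x : ℝ) : ℝ :=
  (σX * σY / (n : ℝ)) ^ 3 * (1 - ρ ^ 2) * (1 + ρ) * x * iteratedDeriv 3 f x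
    + (σX * σY / (n : ℝ)) ^ 2 * (1 + ρ)
        * ((n : ℝ) * (σX * σY / (n : ℝ)) * (1 - ρ ^ 2) + (3 * ρ - 1) * x) * iteratedDeriv 2 f x
    + (σX * σY / (n : ℝ))
        * ((n : ℝ) * (σX * σY / (n : ℝ))
              * (2 * ρ ^ 2 + ρ - 1 - (1 - ρ) * (μX / σX) * (μY / σY))
            - (3 * ρ + 1) * x) * iteratedDeriv 1 f x
    + (x - (n : ℝ) * (σX * σY / (n : ℝ)) * ρ - μX * μY) * f x

section CharFunPN

open Complex

lemma integral_cexp_quadratic_gaussianReal {a : ℂ} (ha : a.re < 1 / 2) (c d : ℂ) :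
    ∫ u : ℝ, cexp (a * u ^ 2 + c * u + d) ∂(gaussianReal 0 1)
      = (√(2 * Real.pi) : ℂ)⁻¹ * ((Real.pi / (1 / 2 - a)) ^ (1 / 2 : ℂ)
          * cexp (d + c ^ 2 / (4 * (1 / 2 - a)))) := by
  have hre : (a - 1 / 2).re < 0 := by
    have : (1 / 2 : ℂ).re = 1 / 2 := by norm_num
    rw [sub_re, this]; linarith
  have h := integral_cexp_quadratic hre c d
  rw [neg_sub] at h
  have hne : (1 / 2 - a) ≠ 0 := by
    intro h0
    rw [← neg_sub, h0] at hre
    simp at hre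
  have hd : d - c ^ 2 / (4 * (a - 1 / 2)) = d + c ^ 2 / (4 * (1 / 2 - a)) := by
    rw [← neg_sub (1 / 2) a, mul_neg, div_neg, sub_neg_eq_add]
  rw [hd] at h
  rw [integral_gaussianReal_eq_integral_smul one_ne_zero, ← h, ← integral_const_mul]
  congr with u
  rw [real_smul, gaussianPDFReal]
  push_cast
  rw [mul_assoc, ← Complex.exp_add]
  simp only [mul_one, sub_zero]
  ring_nf

/-- The quadratic factor `(1 - (1 + ρ) τ) (1 + (1 - ρ) τ)` in the characteristic function of the
product-normal law. -/
noncomputable def pnQuad (ρ : ℝ) (τ : ℂ) : ℂ := (1 - (1 + ρ) * τ) * (1 + (1 - ρ) * τ)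

/-- The function which, evaluated at `τ = i t σX σY`, is the characteristic function of
`PN (σX * r) (σY * r) σX σY ρ`. -/
noncomputable def pnTransform (ρ r : ℝ) (τ : ℂ) : ℂ :=
  (√(2 * Real.pi) : ℂ)⁻¹ * ((Real.pi / (pnQuad ρ τ / 2)) ^ (1 / 2 : ℂ)
    * cexp (r ^ 2 * τ / (1 - (1 + ρ) * τ)))

/-- The logarithmic derivative of `pnTransform`. -/
noncomputable def pnLogDeriv (ρ r : ℝ) (τ : ℂ) : ℂ :=
  (1 + ρ) / (2 * (1 - (1 + ρ) * τ)) - (1 - ρ) / (2 * (1 + (1 - ρ) * τ))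
    + r ^ 2 / (1 - (1 + ρ) * τ) ^ 2

lemma one_add_real_mul_imaginary_ne_zero (a x : ℝ) : (1 + a * (x * I) : ℂ) ≠ 0 := by
  intro h
  have := congrArg re h
  simp at this

lemma pnQuad_left_ne_zero (ρ x : ℝ) : (1 - (1 + ρ) * (x * I) : ℂ) ≠ 0 := by
  have := one_add_real_mul_imaginary_ne_zero (-(1 + ρ)) x
  push_cast at this
  convert this using 1
  ring

lemma pnQuad_right_ne_zero (ρ x : ℝ) : (1 + (1 - ρ) * (x * I) : ℂ) ≠ 0 := by
  have := one_add_real_mul_imaginary_ne_zero (1 - ρ) x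
  push_cast at this
  exact this

lemma pnQuad_re (ρ x : ℝ) : (pnQuad ρ (x * I)).re = 1 + x ^ 2 * (1 - ρ ^ 2) := by
  simp [pnQuad]
  ring

lemma pnQuad_re_pos {ρ : ℝ} (hρ₁ : -1 < ρ) (hρ₂ : ρ < 1) (x : ℝ) :
    0 < (pnQuad ρ (x * I)).re := by
  rw [pnQuad_re]
  have : 0 < 1 - ρ ^ 2 := by nlinarith
  positivity

lemma pi_div_pnQuad_mem_slitPlane {ρ : ℝ} (hρ₁ : -1 < ρ) (hρ₂ : ρ < 1) (x : ℝ) :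
    Real.pi / (pnQuad ρ (x * I) / 2) ∈ slitPlane := by
  left
  have h := pnQuad_re_pos hρ₁ hρ₂ x
  have hne : pnQuad ρ (x * I) ≠ 0 := fun h0 => by simp [h0] at h
  have : (Real.pi / (pnQuad ρ (x * I) / 2) : ℂ)
      = ((2 * Real.pi : ℝ) : ℂ) * (pnQuad ρ (x * I))⁻¹ := by
    push_cast
    field_simp
  rw [this, re_ofReal_mul, inv_re]
  have := normSq_pos.2 hne
  positivity

lemma pnTransform_ne_zero {ρ : ℝ} (hρ₁ : -1 < ρ) (hρ₂ : ρ < 1) (r x : ℝ) :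
    pnTransform ρ r (x * I) ≠ 0 := by
  have h := slitPlane_ne_zero (pi_div_pnQuad_mem_slitPlane hρ₁ hρ₂ x)
  refine mul_ne_zero (inv_ne_zero ?_) (mul_ne_zero ?_ (Complex.exp_ne_zero _))
  · have : 0 < √(2 * Real.pi) := by positivity
    exact_mod_cast this.ne'
  · rw [Ne, cpow_eq_zero_iff]
    exact fun h' => h h'.1

lemma hasDerivAt_pnTransform {ρ : ℝ} (hρ₁ : -1 < ρ) (hρ₂ : ρ < 1) (r x : ℝ) :
    HasDerivAt (pnTransform ρ r) (pnLogDeriv ρ r (x * I) * pnTransform ρ r (x * I)) (x * I) := by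
  have hs := pi_div_pnQuad_mem_slitPlane hρ₁ hρ₂ x
  have hA := pnQuad_left_ne_zero ρ x
  have hB := pnQuad_right_ne_zero ρ x
  set τ : ℂ := x * I with hτ
  have hpi : (Real.pi : ℂ) ≠ 0 := by exact_mod_cast Real.pi_ne_zero
  have hdA : HasDerivAt (fun z : ℂ => 1 - (1 + ρ) * z) (-(1 + ρ)) τ := by
    simpa using ((hasDerivAt_id τ).const_mul (1 + ρ : ℂ)).const_sub 1
  have hdB : HasDerivAt (fun z : ℂ => 1 + (1 - ρ) * z) (1 - ρ) τ := by
    simpa using ((hasDerivAt_id τ).const_mul (1 - ρ : ℂ)).const_add 1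
  have hQ : pnQuad ρ τ ≠ 0 := mul_ne_zero hA hB
  have hdP := (((hasDerivAt_const τ (Real.pi : ℂ)).fun_div
    ((hdA.fun_mul hdB).div_const 2) (div_ne_zero hQ two_ne_zero)).cpow_const
      (c := 1 / 2) hs)
  have hdE := ((((hasDerivAt_id τ).const_mul (r ^ 2 : ℂ)).fun_div hdA hA).cexp)
  have := (hdP.fun_mul hdE).const_mul ((√(2 * Real.pi) : ℂ)⁻¹)
  refine this.congr_deriv ?_
  have hpow : (Real.pi / (pnQuad ρ τ / 2)) ^ (1 / 2 - 1 : ℂ)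
      = (Real.pi / (pnQuad ρ τ / 2)) ^ (1 / 2 : ℂ) * (pnQuad ρ τ / 2) / Real.pi := by
    rw [cpow_sub _ _ (slitPlane_ne_zero hs), cpow_one]
    field_simp
  change (√(2 * Real.pi) : ℂ)⁻¹ * (1 / 2 * (Real.pi / (pnQuad ρ τ / 2)) ^ (1 / 2 - 1 : ℂ) * _ * _
    + (Real.pi / (pnQuad ρ τ / 2)) ^ (1 / 2 : ℂ) * _) = _
  rw [hpow, pnTransform, pnLogDeriv]
  simp only [id]
  generalize (Real.pi / (pnQuad ρ τ / 2)) ^ (1 / 2 : ℂ) = p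
  generalize cexp (r ^ 2 * τ / (1 - (1 + ρ) * τ)) = e
  rw [pnQuad]
  have hA' := hA
  have hB' := hB
  rw [mul_comm _ τ] at hA' hB'
  field_simp
  ring

lemma measurable_pnMap (μX μY σX σY ρ : ℝ) : Measurable (fun p : ℝ × ℝ =>
    (μX + σX * p.1) * (μY + σY * (ρ * p.1 + √(1 - ρ ^ 2) * p.2))) := by
  fun_prop

instance isProbabilityMeasure_PN (μX μY σX σY ρ : ℝ) :
    IsProbabilityMeasure (PN μX μY σX σY ρ) :=
  Measure.isProbabilityMeasure_map (measurable_pnMap ..).aemeasurable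

lemma charFun_PN {σX σY ρ : ℝ} (hρ₁ : -1 < ρ) (hρ₂ : ρ < 1) (r t : ℝ) :
    charFun (PN (σX * r) (σY * r) σX σY ρ) t = pnTransform ρ r ((t * (σX * σY) : ℝ) * I) := by
  have hA := pnQuad_left_ne_zero ρ (t * (σX * σY))
  have hre := pnQuad_re_pos hρ₁ hρ₂ (t * (σX * σY))
  set τ : ℂ := (t * (σX * σY) : ℝ) * I with hτ
  have hsq : (√(1 - ρ ^ 2)) ^ 2 = 1 - ρ ^ 2 := Real.sq_sqrt (by nlinarith)
  have hsqC : (√(1 - ρ ^ 2) : ℂ) ^ 2 = 1 - ρ ^ 2 := by exact_mod_cast hsq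
  rw [charFun_apply_real, PN, integral_map (measurable_pnMap ..).aemeasurable (by fun_prop),
    integral_prod]
  · have inner (u : ℝ) : ∫ v : ℝ, cexp (t * ((σX * r + σX * u) *
          (σY * r + σY * (ρ * u + √(1 - ρ ^ 2) * v)) : ℝ) * I) ∂(gaussianReal 0 1)
        = cexp ((τ * ρ + τ ^ 2 * (1 - ρ ^ 2) / 2) * u ^ 2
            + (τ * r * (1 + ρ) + τ ^ 2 * r * (1 - ρ ^ 2)) * u
            + (τ * r ^ 2 + τ ^ 2 * r ^ 2 * (1 - ρ ^ 2) / 2)) := by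
      have hG := charFun_gaussianReal (μ := 0) (v := 1) (t * (σX * σY) * (r + u) * √(1 - ρ ^ 2))
      rw [charFun_apply_real] at hG
      have hsplit (v : ℝ) : cexp (t * ((σX * r + σX * u) *
          (σY * r + σY * (ρ * u + √(1 - ρ ^ 2) * v)) : ℝ) * I)
          = cexp (τ * (r + u) * (r + ρ * u))
            * cexp ((t * (σX * σY) * (r + u) * √(1 - ρ ^ 2) : ℝ) * v * I) := by
        rw [← Complex.exp_add, hτ]
        push_cast
        ring_nf
      simp_rw [hsplit]
      rw [integral_const_mul, hG, ← Complex.exp_add]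
      congr 1
      rw [hτ]
      push_cast
      simp only [mul_zero, zero_mul, zero_sub, one_mul, mul_pow, hsqC, I_sq]
      ring
    simp_rw [inner]
    have hquad : (1 / 2 - (τ * ρ + τ ^ 2 * (1 - ρ ^ 2) / 2) : ℂ) = pnQuad ρ τ / 2 := by
      rw [pnQuad]; ring
    rw [integral_cexp_quadratic_gaussianReal, hquad, pnTransform]
    · congr 3
      have hB := pnQuad_right_ne_zero ρ (t * (σX * σY))
      rw [← hτ] at hB
      rw [mul_comm _ τ] at hA hB
      rw [pnQuad]
      field_simp
      ring
    · have : (pnQuad ρ τ / 2).re = 1 / 2 - (τ * ρ + τ ^ 2 * (1 - ρ ^ 2) / 2).re := by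
        rw [← hquad, sub_re]; norm_num
      rw [show (pnQuad ρ τ / 2) = ((1 / 2 : ℝ) : ℂ) * pnQuad ρ τ by push_cast; ring,
        re_ofReal_mul] at this
      linarith
  · refine Integrable.of_bound (C := 1) (by fun_prop) (ae_of_all _ fun p => ?_)
    rw [← ofReal_mul, norm_exp_ofReal_mul_I]

lemma integrable_id_PN (μX μY σX σY ρ : ℝ) : Integrable id (PN μX μY σX σY ρ) := by
  rw [PN, integrable_map_measure aestronglyMeasurable_id (measurable_pnMap ..).aemeasurable]
  have h := memLp_id_gaussianReal (μ := 0) (v := 1) 2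
  have h1 : MemLp (fun p : ℝ × ℝ => p.1) 2 ((gaussianReal 0 1).prod (gaussianReal 0 1)) :=
    h.comp_fst _
  have h2 : MemLp (fun p : ℝ × ℝ => p.2) 2 ((gaussianReal 0 1).prod (gaussianReal 0 1)) :=
    h.comp_snd _
  exact ((memLp_const μX).add (h1.const_mul σX)).integrable_mul
    ((memLp_const μY).add (((h1.const_mul ρ).add (h2.const_mul √(1 - ρ ^ 2))).const_mul σY))

instance isProbabilityMeasure_PNbar (n : ℕ) (μX μY σX σY ρ : ℝ) :
    IsProbabilityMeasure (PNbar n μX μY σX σY ρ) :=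
  Measure.isProbabilityMeasure_map (by fun_prop)

lemma integrable_id_PNbar (n : ℕ) (μX μY σX σY ρ : ℝ) :
    Integrable id (PNbar n μX μY σX σY ρ) := by
  rw [PNbar, integrable_map_measure aestronglyMeasurable_id (by fun_prop)]
  exact (integrable_finsetSum _ fun i _ => integrable_comp_eval (i := i) (f := id)
    (integrable_id_PN μX μY σX σY ρ)).div_const _

lemma charFun_PNbar (n : ℕ) (μX μY σX σY ρ t : ℝ) :
    charFun (PNbar n μX μY σX σY ρ) t = charFun (PN μX μY σX σY ρ) (t / n) ^ n := by
  have hmap : PNbar n μX μY σX σY ρ = ((Measure.pi fun _ : Fin n => PN μX μY σX σY ρ).map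
      (fun ω => ∑ i, ω i)).map ((n : ℝ)⁻¹ * ·) := by
    rw [PNbar, Measure.map_map (by fun_prop) (by fun_prop)]
    congr with ω
    simp [div_eq_inv_mul]
  rw [hmap, charFun_map_mul, charFun_map_sum_pi_eq_prod]
  simp [div_eq_inv_mul]

lemma charFun_PNbar_ne_zero {σX σY ρ : ℝ} (hρ₁ : -1 < ρ) (hρ₂ : ρ < 1) (n : ℕ) (r t : ℝ) :
    charFun (PNbar n (σX * r) (σY * r) σX σY ρ) t ≠ 0 := by
  rw [charFun_PNbar, charFun_PN hρ₁ hρ₂]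
  exact pow_ne_zero _ (pnTransform_ne_zero hρ₁ hρ₂ _ _)

lemma hasDerivAt_charFun_PNbar {σX σY ρ : ℝ} (hρ₁ : -1 < ρ) (hρ₂ : ρ < 1) {n : ℕ} (hn : n ≠ 0)
    (r t : ℝ) :
    HasDerivAt (charFun (PNbar n (σX * r) (σY * r) σX σY ρ))
      (σX * σY * I * pnLogDeriv ρ r ((t / n * (σX * σY) : ℝ) * I)
        * charFun (PNbar n (σX * r) (σY * r) σX σY ρ) t) t := by
  have heq : charFun (PNbar n (σX * r) (σY * r) σX σY ρ)
      = fun t : ℝ => pnTransform ρ r ((t / n * (σX * σY) : ℝ) * I) ^ n := by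
    ext s
    rw [charFun_PNbar, charFun_PN hρ₁ hρ₂]
  have hin : HasDerivAt (fun t : ℝ => ((t / n * (σX * σY) : ℝ) * I : ℂ))
      ((1 / n * (σX * σY) : ℝ) * I) t :=
    ((((hasDerivAt_id t).div_const (n : ℝ)).mul_const (σX * σY)).ofReal_comp).mul_const I
  have hout := hasDerivAt_pnTransform hρ₁ hρ₂ r (t / n * (σX * σY))
  have h := (HasDerivAt.comp t hout hin).fun_pow n
  rw [heq]
  refine h.congr_deriv ?_
  obtain ⟨m, rfl⟩ := Nat.exists_eq_succ_of_ne_zero hn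
  simp only [Nat.succ_eq_add_one, Nat.add_sub_cancel, Function.comp, pow_succ _ m]
  have : ((m : ℂ) + 1) ≠ 0 := by exact_mod_cast Nat.succ_ne_zero m
  push_cast
  field_simp

end CharFunPN

section TrigFunctions

lemma deriv_trig (t a b : ℝ) :
    deriv (fun x => a * Real.cos (t * x) + b * Real.sin (t * x))
      = fun x => (t * b) * Real.cos (t * x) + (-(t * a)) * Real.sin (t * x) := by
  ext x
  have hx : HasDerivAt (fun x : ℝ => t * x) t x := by
    simpa using (hasDerivAt_id x).const_mul t
  rw [((hx.cos.const_mul a).fun_add (hx.sin.const_mul b)).deriv]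
  ring

lemma exists_iteratedDeriv_trig (t : ℝ) (m : ℕ) (a b : ℝ) : ∃ c d : ℝ,
    iteratedDeriv m (fun x => a * Real.cos (t * x) + b * Real.sin (t * x))
      = fun x => c * Real.cos (t * x) + d * Real.sin (t * x) := by
  induction m generalizing a b with
  | zero => exact ⟨a, b, by simp⟩
  | succ m ih =>
    rw [iteratedDeriv_succ', deriv_trig]
    exact ih _ _

lemma abs_trig_le (t a b x : ℝ) :
    ‖a * Real.cos (t * x) + b * Real.sin (t * x)‖ ≤ |a| + |b| := by
  refine (norm_add_le _ _).trans (add_le_add ?_ ?_) <;> rw [norm_mul, Real.norm_eq_abs]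
  · exact mul_le_of_le_one_right (abs_nonneg _) (Real.abs_cos_le_one _)
  · exact mul_le_of_le_one_right (abs_nonneg _) (Real.abs_sin_le_one _)

variable {μ : Measure ℝ}

lemma integrable_trig [IsFiniteMeasure μ] (t a b : ℝ) :
    Integrable (fun x => a * Real.cos (t * x) + b * Real.sin (t * x)) μ :=
  Integrable.of_bound (by fun_prop) (|a| + |b|) (ae_of_all _ (abs_trig_le t a b))

lemma integrable_id_mul_trig (hμ : Integrable id μ) (t a b : ℝ) :
    Integrable (fun x => x * (a * Real.cos (t * x) + b * Real.sin (t * x))) μ :=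
  Integrable.mul_bdd (c := |a| + |b|) hμ (by fun_prop) (ae_of_all _ (abs_trig_le t a b))

lemma integrable_iteratedDeriv_trig [IsFiniteMeasure μ] (t a b : ℝ) (m : ℕ) : Integrable (iteratedDeriv m
    (fun x => a * Real.cos (t * x) + b * Real.sin (t * x))) μ := by
  obtain ⟨c, d, h⟩ := exists_iteratedDeriv_trig t m a b
  rw [h]
  exact integrable_trig t c d

lemma integrable_id_mul_iteratedDeriv_trig (hμ : Integrable id μ) (t a b : ℝ) (m : ℕ) :
    Integrable (fun x => x * iteratedDeriv m
      (fun x => a * Real.cos (t * x) + b * Real.sin (t * x)) x) μ := by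
  obtain ⟨c, d, h⟩ := exists_iteratedDeriv_trig t m a b
  simp only [h]
  exact integrable_id_mul_trig hμ t c d

lemma integrable_A2_trig [IsFiniteMeasure μ] (hμ : Integrable id μ) (n : ℕ) (μX μY σX σY ρ t a b : ℝ) :
    Integrable (A2 n μX μY σX σY ρ
      (fun x => a * Real.cos (t * x) + b * Real.sin (t * x))) μ := by
  have h (m : ℕ) (c d : ℝ) : Integrable (fun x => (c + d * x) * iteratedDeriv m
      (fun x => a * Real.cos (t * x) + b * Real.sin (t * x)) x) μ := by
    convert! ((integrable_iteratedDeriv_trig t a b m).const_mul c).add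
      ((integrable_id_mul_iteratedDeriv_trig hμ t a b m).const_mul d) using 2 with x
    simp only [Pi.add_apply]
    ring
  set s := σX * σY / (n : ℝ) with hs
  have hsum := (((h 3 0 (s ^ 3 * (1 - ρ ^ 2) * (1 + ρ))).add
    (h 2 (s ^ 2 * (1 + ρ) * (n * s * (1 - ρ ^ 2))) (s ^ 2 * (1 + ρ) * (3 * ρ - 1)))).add
    (h 1 (s * (n * s * (2 * ρ ^ 2 + ρ - 1 - (1 - ρ) * (μX / σX) * (μY / σY))))
      (-(s * (3 * ρ + 1))))).add (h 0 (-(n * s * ρ) - μX * μY) 1)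
  refine hsum.congr (ae_of_all _ fun x => ?_)
  simp only [A2, Pi.add_apply, iteratedDeriv_zero, ← hs]
  ring

open Complex in
/-- On `x ↦ exp (i t x)`, the operator `A2` acts as multiplication by an affine function of `x`
with coefficients depending on `t`. -/
lemma A2_cos_add_A2_sin_mul_I {σX σY ρ : ℝ} (hσX : σX ≠ 0) (hσY : σY ≠ 0) {n : ℕ} (hn : n ≠ 0)
    (r t x : ℝ) :
    (A2 n (σX * r) (σY * r) σX σY ρ (fun x => 1 * Real.cos (t * x) + 0 * Real.sin (t * x)) x : ℂ)
      + A2 n (σX * r) (σY * r) σX σY ρ (fun x => 0 * Real.cos (t * x) + 1 * Real.sin (t * x)) x * I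
      = (1 - (1 + ρ) * ((t / n * (σX * σY) : ℝ) * I)) ^ 2
          * (1 + (1 - ρ) * ((t / n * (σX * σY) : ℝ) * I))
          * (x - σX * σY * pnLogDeriv ρ r ((t / n * (σX * σY) : ℝ) * I)) * cexp (t * x * I) := by
  have hA := pnQuad_left_ne_zero ρ (t / n * (σX * σY))
  have hB := pnQuad_right_ne_zero ρ (t / n * (σX * σY))
  have hn' : (n : ℂ) ≠ 0 := by exact_mod_cast hn
  have hexp : cexp (t * x * I) = Real.cos (t * x) + Real.sin (t * x) * I := by
    rw [exp_mul_I]; push_cast; rfl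
  have hrX : σX * r / σX = r := by field_simp
  have hrY : σY * r / σY = r := by field_simp
  have hlog : (1 - (1 + ρ) * ((t / n * (σX * σY) : ℝ) * I)) ^ 2
          * (1 + (1 - ρ) * ((t / n * (σX * σY) : ℝ) * I))
          * pnLogDeriv ρ r ((t / n * (σX * σY) : ℝ) * I)
      = ρ + r ^ 2 + (1 - ρ - 2 * ρ ^ 2 + (1 - ρ) * r ^ 2) * ((t / n * (σX * σY) : ℝ) * I)
        - (1 - ρ) * (1 + ρ) ^ 2 * ((t / n * (σX * σY) : ℝ) * I) ^ 2 := by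
    rw [pnLogDeriv]
    generalize (((t / n * (σX * σY) : ℝ) : ℂ) * I) = τ at *
    have hA' := hA
    have hB' := hB
    rw [mul_comm _ τ] at hA' hB'
    field_simp
    ring
  rw [mul_sub, mul_left_comm _ (σX * σY : ℂ), hlog, hexp]
  simp only [A2, iteratedDeriv_succ', deriv_trig, iteratedDeriv_zero, hrX, hrY]
  push_cast
  generalize (Complex.cos (t * x)) = C
  generalize (Complex.sin (t * x)) = S
  have hI3 : I ^ 3 = -I := by rw [pow_succ, I_sq]; ring
  have hI4 : I ^ 4 = 1 := I_pow_four
  field_simp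
  ring_nf
  simp only [I_sq, hI3, hI4]
  ring

end TrigFunctions

section CharFunODE

open Complex

variable {μ ν : Measure ℝ} [IsProbabilityMeasure μ] [IsProbabilityMeasure ν]

lemma hasDerivAt_charFun (hμ : Integrable id μ) (t : ℝ) :
    HasDerivAt (charFun μ) (I * ∫ x : ℝ, x * cexp (t * x * I) ∂μ) t := by
  have hL : MemLp id ((1 : ℕ) : ENNReal) μ := by simpa using memLp_one_iff_integrable.2 hμ
  have hd : DifferentiableAt ℝ (charFun μ) t :=
    (contDiff_charFun hL).differentiable (by simp) t
  have h := iteratedDeriv_charFun (t := t) hL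
  simp only [iteratedDeriv_one, pow_one] at h
  exact h ▸ hd.hasDerivAt

lemma integral_id_mul_cexp_eq (hμ : Integrable id μ) (t : ℝ) (c : ℂ)
    (h : ∫ x : ℝ, (x - c) * cexp (t * x * I) ∂μ = 0) :
    ∫ x : ℝ, x * cexp (t * x * I) ∂μ = c * charFun μ t := by
  have hb : ∀ᵐ x : ℝ ∂μ, ‖cexp (t * x * I)‖ ≤ 1 :=
    ae_of_all _ fun x => by rw [← ofReal_mul, norm_exp_ofReal_mul_I]
  have h1 : Integrable (fun x : ℝ => x * cexp (t * x * I)) μ :=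
    Integrable.mul_bdd (c := 1) hμ.ofReal (by fun_prop) hb
  have h2 : Integrable (fun x : ℝ => c * cexp (t * x * I)) μ :=
    (Integrable.of_bound (by fun_prop) 1 hb).const_mul c
  simp_rw [sub_mul] at h
  rw [integral_sub h1 h2, integral_const_mul, ← charFun_apply_real] at h
  exact sub_eq_zero.1 h

lemma eq_of_hasDerivAt_charFun {L : ℝ → ℂ} (hν0 : ∀ t, charFun ν t ≠ 0)
    (hν : ∀ t, HasDerivAt (charFun ν) (L t * charFun ν t) t)
    (hμ : ∀ t, HasDerivAt (charFun μ) (L t * charFun μ t) t) : μ = ν := by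
  have hq (t : ℝ) : HasDerivAt (fun t => charFun μ t / charFun ν t) 0 t :=
    ((hμ t).fun_div (hν t) (hν0 t)).congr_deriv (by ring)
  refine Measure.ext_of_charFun (funext fun t => ?_)
  have h := is_const_of_deriv_eq_zero (fun t => (hq t).differentiableAt) (fun t => (hq t).deriv) t 0
  simp only [charFun_zero, probReal_univ, ofReal_one, div_one] at h
  exact eq_of_div_eq_one h

end CharFunODE

/-- Sufficiency part of the third-order Stein characterisation in the case `μX/σX = μY/σY`:
if `W` is an integrable real random variable such that `E[A₂ f (W)] = 0` for every `C³` function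
`f` satisfying the integrability conditions `E|f⁽ᵐ⁾(Z̄ₙ)| < ∞` for `m = 0,1,2` and
`E|Z̄ₙ f⁽ᵐ⁾(Z̄ₙ)| < ∞` for `m = 0,1,2,3` (and for which the left-hand side is defined), then
`W` is distributed as `Z̄ₙ`, the mean of `n` independent `PN(μX, μY; σX², σY²; ρ)`
random variables. -/
theorem stein_sufficiency_third_order_PNbar
    {Ω : Type*} [MeasurableSpace Ω] (P : Measure Ω) [IsProbabilityMeasure P]
    (μX μY σX σY ρ : ℝ) (hσX : 0 < σX) (hσY : 0 < σY)
    (hρ₁ : -1 < ρ) (hρ₂ : ρ < 1) (heq : μX / σX = μY / σY)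
    (n : ℕ) (hn : 1 ≤ n)
    (W : Ω → ℝ) (hW : Measurable W) (hWint : Integrable W P)
    (hstein : ∀ f : ℝ → ℝ, ContDiff ℝ 3 f →
      (∀ m ≤ 2, Integrable (iteratedDeriv m f) (PNbar n μX μY σX σY ρ)) →
      (∀ m ≤ 3, Integrable (fun x => x * iteratedDeriv m f x) (PNbar n μX μY σX σY ρ)) →
      Integrable (fun ω => A2 n μX μY σX σY ρ f (W ω)) P →
      ∫ ω, A2 n μX μY σX σY ρ f (W ω) ∂P = 0) :
    Measure.map W P = PNbar n μX μY σX σY ρ := by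
  obtain ⟨r, rfl, rfl⟩ : ∃ r, μX = σX * r ∧ μY = σY * r :=
    ⟨μX / σX, by field_simp, by rw [heq]; field_simp⟩
  have hn0 : n ≠ 0 := by omega
  have : IsProbabilityMeasure (P.map W) := Measure.isProbabilityMeasure_map hW.aemeasurable
  have hid : Integrable id (P.map W) :=
    (integrable_map_measure aestronglyMeasurable_id hW.aemeasurable).2 hWint
  have hA2int (t a b : ℝ) := integrable_A2_trig hid n (σX * r) (σY * r) σX σY ρ t a b
  have hzero (t a b : ℝ) : ∫ x, A2 n (σX * r) (σY * r) σX σY ρ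
      (fun x => a * Real.cos (t * x) + b * Real.sin (t * x)) x ∂(P.map W) = 0 := by
    rw [integral_map hW.aemeasurable (hA2int t a b).aestronglyMeasurable]
    exact hstein _ (by fun_prop) (fun m _ => integrable_iteratedDeriv_trig t a b m)
      (fun m _ => integrable_id_mul_iteratedDeriv_trig (integrable_id_PNbar ..) t a b m)
      ((integrable_map_measure (hA2int t a b).aestronglyMeasurable hW.aemeasurable).1
        (hA2int t a b))
  refine eq_of_hasDerivAt_charFun (charFun_PNbar_ne_zero hρ₁ hρ₂ n r)
    (hasDerivAt_charFun_PNbar hρ₁ hρ₂ hn0 r) fun t => ?_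
  have hint := integral_id_mul_cexp_eq (μ := P.map W) hid t
    (pnLogDeriv ρ r ((t / n * (σX * σY) : ℝ) * Complex.I) * (σX * σY)) ?_
  · refine (hasDerivAt_charFun hid t).congr_deriv ?_
    rw [hint]
    ring
  · have hsum : ∫ x, ((A2 n (σX * r) (σY * r) σX σY ρ
          (fun x => 1 * Real.cos (t * x) + 0 * Real.sin (t * x)) x : ℂ)
        + A2 n (σX * r) (σY * r) σX σY ρ
          (fun x => 0 * Real.cos (t * x) + 1 * Real.sin (t * x)) x * Complex.I) ∂(P.map W) = 0 := by
      rw [integral_add (hA2int t 1 0).ofReal ((hA2int t 0 1).ofReal.mul_const _),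
        integral_mul_const, integral_complex_ofReal, integral_complex_ofReal, hzero, hzero]
      simp
    simp_rw [A2_cos_add_A2_sin_mul_I hσX.ne' hσY.ne' hn0] at hsum
    simp_rw [mul_assoc (_ * _), integral_const_mul] at hsum
    have hne := mul_ne_zero (pow_ne_zero 2 (pnQuad_left_ne_zero ρ (t / n * (σX * σY))))
      (pnQuad_right_ne_zero ρ (t / n * (σX * σY)))
    rw [mul_comm (pnLogDeriv _ _ _)]
    exact (mul_eq_zero.1 hsum).resolve_left hne
end

section
/- Suppose μ_X/σ_X = μ_Y/σ_Y. Let n ≥ 1, let Z̄_n be the mean of n independent PN(μ_X,μ_Y;σ_X²,σ_Y²;ρ) random variables, and write μ'_k = E[Z̄_n^k] (with μ'_k = 0 by convention for k < 0 and μ'_0 = 1). Then for every integer k ≥ 0: μ'_{k+1} = (μ_Xμ_Y + s_n(ρn + (3ρ+1)k))·μ'_k − s_n k(μ_Xμ_Y(ρ−1) + s_n(n(2ρ²+ρ−1) + (1+ρ)(3ρ−1)(k−1)))·μ'_{k−1} − s_n³(1+ρ)(1−ρ²)k(k−1)(k−2+n)·μ'_{k−2}. -/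
open MeasureTheory ProbabilityTheory

/-- Leibniz rule at the origin for multiplication by the identity. -/
lemma iteratedDeriv_id_mul_zero {g : ℝ → ℝ} (hg : AnalyticAt ℝ g 0) (k : ℕ) :
    iteratedDeriv k (fun t => t * g t) 0 = k * iteratedDeriv (k - 1) g 0 := by
  rw [iteratedDeriv_fun_mul (by fun_prop) hg.contDiffAt]
  simp only [iteratedDeriv_fun_id_zero]
  rcases k with _ | k
  · simp
  · rw [Finset.sum_eq_single 1]
    · simp
    · intro i _ hi
      simp [hi]
    · intro h
      simp at h

/-- A first-order linear differential equation with polynomial coefficients turns into a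
recursion for the derivatives at the origin. -/
lemma iteratedDeriv_recursion_of_ode {φ : ℝ → ℝ} (hφ : AnalyticAt ℝ φ 0)
    (a₁ a₂ a₃ b₀ b₁ b₂ : ℝ)
    (hode : ∀ᶠ t in nhds (0 : ℝ), (1 + a₁ * t + a₂ * t ^ 2 + a₃ * t ^ 3) * deriv φ t
      = (b₀ + b₁ * t + b₂ * t ^ 2) * φ t) (k : ℕ) :
    iteratedDeriv (k + 1) φ 0 + a₁ * (k * iteratedDeriv k φ 0)
        + a₂ * (k * (k - 1) * iteratedDeriv (k - 1) φ 0)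
        + a₃ * (k * (k - 1) * (k - 2) * iteratedDeriv (k - 2) φ 0)
      = b₀ * iteratedDeriv k φ 0 + b₁ * (k * iteratedDeriv (k - 1) φ 0)
        + b₂ * (k * (k - 1) * iteratedDeriv (k - 2) φ 0) := by
  have hψ : AnalyticAt ℝ (deriv φ) 0 := hφ.deriv
  have h1 : AnalyticAt ℝ (fun t => t * deriv φ t) 0 := by fun_prop
  have h2 : AnalyticAt ℝ (fun t => t * (t * deriv φ t)) 0 := by fun_prop
  have g1 : AnalyticAt ℝ (fun t => t * φ t) 0 := by fun_prop
  have key : (fun t => deriv φ t + a₁ * (t * deriv φ t) + a₂ * (t * (t * deriv φ t))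
      + a₃ * (t * (t * (t * deriv φ t)))) =ᶠ[nhds 0]
      (fun t => b₀ * φ t + b₁ * (t * φ t) + b₂ * (t * (t * φ t))) := by
    filter_upwards [hode] with t ht
    linear_combination ht
  have := key.iteratedDeriv_eq k
  rw [iteratedDeriv_fun_add (AnalyticAt.contDiffAt (by fun_prop))
      (AnalyticAt.contDiffAt (by fun_prop)),
    iteratedDeriv_fun_add (AnalyticAt.contDiffAt (by fun_prop))
      (AnalyticAt.contDiffAt (by fun_prop)),
    iteratedDeriv_fun_add (AnalyticAt.contDiffAt (by fun_prop))
      (AnalyticAt.contDiffAt (by fun_prop)),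
    iteratedDeriv_fun_add (AnalyticAt.contDiffAt (by fun_prop))
      (AnalyticAt.contDiffAt (by fun_prop)),
    iteratedDeriv_fun_add (AnalyticAt.contDiffAt (by fun_prop))
      (AnalyticAt.contDiffAt (by fun_prop))] at this
  simp only [iteratedDeriv_const_mul_field, iteratedDeriv_id_mul_zero h2,
    iteratedDeriv_id_mul_zero h1, iteratedDeriv_id_mul_zero hψ, iteratedDeriv_id_mul_zero g1,
    iteratedDeriv_id_mul_zero hφ, ← iteratedDeriv_succ'] at this
  rcases k with _ | _ | _ | k
  · simpa using this
  · simpa using this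
  · norm_num at this ⊢
    linear_combination this
  · simp only [Nat.add_sub_cancel, show k + 1 + 1 + 1 - 2 = k + 1 from rfl,
      show k + 1 + 1 - 1 = k + 1 from rfl, show k + 1 - 1 = k from rfl] at this ⊢
    push_cast at this ⊢
    linear_combination this

/-- Integral of the exponential of a quadratic polynomial against the standard normal law. -/
lemma integrable_and_integral_exp_quadratic_gaussianReal {p : ℝ} (hp : 0 < 1 - 2 * p) (q r : ℝ) :
    Integrable (fun u => Real.exp (p * u ^ 2 + q * u + r)) (gaussianReal 0 1) ∧
      ∫ u, Real.exp (p * u ^ 2 + q * u + r) ∂(gaussianReal 0 1)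
        = (√(1 - 2 * p))⁻¹ * Real.exp (r + q ^ 2 / (2 * (1 - 2 * p))) := by
  set v : NNReal := ⟨(1 - 2 * p)⁻¹, by positivity⟩
  have hvc : (v : ℝ) = (1 - 2 * p)⁻¹ := rfl
  have hv0 : v ≠ 0 := by
    intro h
    have : (v : ℝ) = 0 := by rw [h]; rfl
    rw [hvc] at this
    exact (inv_pos.2 hp).ne' this
  have hpdf : ∀ u, gaussianPDFReal 0 1 u • Real.exp (p * u ^ 2 + q * u + r)
      = ((√(1 - 2 * p))⁻¹ * Real.exp (r + q ^ 2 / (2 * (1 - 2 * p))))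
        * gaussianPDFReal (q / (1 - 2 * p)) v u := by
    intro u
    have hs : √(2 * Real.pi * (1 - 2 * p)⁻¹) = √(2 * Real.pi) * (√(1 - 2 * p))⁻¹ := by
      rw [Real.sqrt_mul (by positivity), Real.sqrt_inv]
    have hpos : 0 < √(1 - 2 * p) := Real.sqrt_pos.2 hp
    simp only [gaussianPDFReal_def, hvc, hs, smul_eq_mul, NNReal.coe_one, mul_one]
    have hE : Real.exp (-(u - 0) ^ 2 / 2) * Real.exp (p * u ^ 2 + q * u + r)
        = Real.exp (r + q ^ 2 / (2 * (1 - 2 * p)))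
          * Real.exp (-(u - q / (1 - 2 * p)) ^ 2 / (2 * (1 - 2 * p)⁻¹)) := by
      rw [← Real.exp_add, ← Real.exp_add]
      congr 1
      field_simp
      ring
    rw [mul_assoc, hE]
    field_simp
  constructor
  · rw [gaussianReal_of_var_ne_zero 0 one_ne_zero,
      integrable_withDensity_iff_integrable_smul' (measurable_gaussianPDF _ _)
        (ae_of_all _ fun _ => gaussianPDF_lt_top)]
    simp only [toReal_gaussianPDF, hpdf]
    exact (integrable_gaussianPDFReal _ _).const_mul _
  · rw [integral_gaussianReal_eq_integral_smul one_ne_zero]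
    simp only [hpdf]
    rw [integral_const_mul, integral_gaussianPDFReal_eq_one _ hv0, mul_one]

/-- The moment generating function, at `τ`, of `(m + U) * (m + ρ * U + √(1 - ρ²) * V)` with `U`,
`V` independent standard normal. -/
noncomputable def equalRatioMGF (m ρ τ : ℝ) : ℝ :=
  (√((1 - (1 + ρ) * τ) * (1 + (1 - ρ) * τ)))⁻¹ * Real.exp (m ^ 2 * τ / (1 - (1 + ρ) * τ))

lemma measurable_productNormal (μX μY σX σY ρ : ℝ) :
    Measurable (fun p : ℝ × ℝ =>
      (μX + σX * p.1) * (μY + σY * (ρ * p.1 + Real.sqrt (1 - ρ ^ 2) * p.2))) := by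
  fun_prop

instance (μX μY σX σY ρ : ℝ) : IsProbabilityMeasure (PN μX μY σX σY ρ) :=
  Measure.isProbabilityMeasure_map (measurable_productNormal _ _ _ _ _).aemeasurable

lemma integrable_and_mgf_PN {m σX σY ρ t : ℝ} (hρ : 0 ≤ 1 - ρ ^ 2)
    (hD : 0 < (1 - (1 + ρ) * (σX * σY * t)) * (1 + (1 - ρ) * (σX * σY * t))) :
    Integrable (fun z => Real.exp (t * z)) (PN (m * σX) (m * σY) σX σY ρ) ∧
      mgf id (PN (m * σX) (m * σY) σX σY ρ) t = equalRatioMGF m ρ (σX * σY * t) := by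
  have hmeas := measurable_productNormal (m * σX) (m * σY) σX σY ρ
  have hexp : Measurable (fun z : ℝ => Real.exp (t * z)) := by fun_prop
  set τ := σX * σY * t with hτ
  set w := √(1 - ρ ^ 2) with hw
  have hw2 : w ^ 2 = 1 - ρ ^ 2 := Real.sq_sqrt hρ
  have hinner := fun u : ℝ => integrable_and_integral_exp_quadratic_gaussianReal (p := 0)
    (by norm_num) (τ * (m + u) * w) (τ * (m + u) * (m + ρ * u))
  have hform : ∀ u v : ℝ, Real.exp (t * ((m * σX + σX * u) * (m * σY + σY * (ρ * u + w * v))))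
      = Real.exp (0 * v ^ 2 + τ * (m + u) * w * v + τ * (m + u) * (m + ρ * u)) := by
    intro u v
    congr 1
    rw [hτ]
    ring
  have hD' : 1 - 2 * (τ * ρ + τ ^ 2 * (1 - ρ ^ 2) / 2)
      = (1 - (1 + ρ) * τ) * (1 + (1 - ρ) * τ) := by ring
  have houter := integrable_and_integral_exp_quadratic_gaussianReal
    (p := τ * ρ + τ ^ 2 * (1 - ρ ^ 2) / 2) (by rw [hD']; exact hD)
    (τ * m * (1 + ρ) + τ ^ 2 * m * (1 - ρ ^ 2)) (τ * m ^ 2 + τ ^ 2 * m ^ 2 * (1 - ρ ^ 2) / 2)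
  have hstep : ∀ u : ℝ,
      ∫ v, Real.exp (t * ((m * σX + σX * u) * (m * σY + σY * (ρ * u + w * v))))
        ∂(gaussianReal 0 1)
      = Real.exp ((τ * ρ + τ ^ 2 * (1 - ρ ^ 2) / 2) * u ^ 2
        + (τ * m * (1 + ρ) + τ ^ 2 * m * (1 - ρ ^ 2)) * u
        + (τ * m ^ 2 + τ ^ 2 * m ^ 2 * (1 - ρ ^ 2) / 2)) := by
    intro u
    simp only [hform, (hinner u).2]
    norm_num
    linear_combination (τ * (m + u)) ^ 2 / 2 * hw2
  have hint : Integrable (fun p : ℝ × ℝ => Real.exp (t * ((m * σX + σX * p.1)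
      * (m * σY + σY * (ρ * p.1 + w * p.2))))) ((gaussianReal 0 1).prod (gaussianReal 0 1)) := by
    refine (integrable_prod_iff (hexp.comp hmeas).aestronglyMeasurable).2 ?_
    refine ⟨ae_of_all _ fun u => ?_, ?_⟩
    · simp only [Function.comp_apply, hform]
      exact (hinner u).1
    · simp only [Function.comp_apply, Real.norm_eq_abs, Real.abs_exp, hstep]
      exact houter.1
  constructor
  · rw [PN, integrable_map_measure hexp.aestronglyMeasurable hmeas.aemeasurable]
    exact hint
  · rw [PN, mgf_id_map hmeas.aemeasurable, mgf, integral_prod _ hint]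
    simp only [hstep, houter.2, hD', equalRatioMGF]
    have h1 := left_ne_zero_of_mul hD.ne'
    have h2 := right_ne_zero_of_mul hD.ne'
    congr 2
    generalize hA : 1 - (1 + ρ) * τ = A at *
    generalize hB : 1 + (1 - ρ) * τ = B at *
    field_simp
    rw [← hA, ← hB]
    ring

lemma integrable_and_mgf_PNbar {m σX σY ρ t : ℝ} (n : ℕ) (hρ : 0 ≤ 1 - ρ ^ 2)
    (hD : 0 < (1 - (1 + ρ) * (σX * σY / n * t)) * (1 + (1 - ρ) * (σX * σY / n * t))) :
    Integrable (fun z => Real.exp (t * z)) (PNbar n (m * σX) (m * σY) σX σY ρ) ∧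
      mgf id (PNbar n (m * σX) (m * σY) σX σY ρ) t
        = equalRatioMGF m ρ (σX * σY / n * t) ^ n := by
  have hmeas : Measurable (fun ω : Fin n → ℝ => (∑ i, ω i) / (n : ℝ)) := by fun_prop
  have hexp : Measurable (fun z : ℝ => Real.exp (t * z)) := by fun_prop
  have hτ : σX * σY / n * t = σX * σY * (t / n) := by ring
  rw [hτ] at hD ⊢
  obtain ⟨hint, hmgf⟩ := integrable_and_mgf_PN (m := m) hρ hD
  have hform : ∀ ω : Fin n → ℝ, Real.exp (t * ((∑ i, ω i) / (n : ℝ)))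
      = ∏ i, Real.exp (t / n * ω i) := by
    intro ω
    rw [← Real.exp_sum, ← Finset.mul_sum]
    congr 1
    ring
  constructor
  · rw [PNbar, integrable_map_measure hexp.aestronglyMeasurable hmeas.aemeasurable]
    simp only [Function.comp_def, hform]
    exact Integrable.fintype_prod fun _ => hint
  · rw [PNbar, mgf_id_map hmeas.aemeasurable, mgf]
    simp only [hform]
    rw [integral_fintype_prod_eq_pow (fun x => Real.exp (t / n * x)), Fintype.card_fin, ← hmgf]
    rfl

lemma hasDerivAt_equalRatioMGF {m ρ τ : ℝ} (h1 : 0 < 1 - (1 + ρ) * τ)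
    (h2 : 0 < 1 + (1 - ρ) * τ) :
    HasDerivAt (equalRatioMGF m ρ)
      (equalRatioMGF m ρ τ * ((1 + ρ) / (1 - (1 + ρ) * τ) / 2 - (1 - ρ) / (1 + (1 - ρ) * τ) / 2
        + m ^ 2 / (1 - (1 + ρ) * τ) ^ 2)) τ := by
  have d1 : HasDerivAt (fun x : ℝ => 1 - (1 + ρ) * x) (-(1 + ρ)) τ := by
    simpa using ((hasDerivAt_id τ).const_mul (1 + ρ)).const_sub 1
  have d2 : HasDerivAt (fun x : ℝ => 1 + (1 - ρ) * x) (1 - ρ) τ := by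
    simpa using ((hasDerivAt_id τ).const_mul (1 - ρ)).const_add 1
  have d3 : HasDerivAt (fun x : ℝ => m ^ 2 * x) (m ^ 2) τ := by
    simpa using (hasDerivAt_id τ).const_mul (m ^ 2)
  have hD := mul_pos h1 h2
  have hS := Real.sqrt_pos.2 hD
  have hS2 := Real.sq_sqrt hD.le
  have := (((d1.mul d2).sqrt hD.ne').inv hS.ne').mul (d3.div d1 h1.ne').exp
  refine this.congr_deriv ?_
  simp only [equalRatioMGF, Pi.mul_apply, Pi.div_apply, Pi.inv_apply]
  set S := √((1 - (1 + ρ) * τ) * (1 + (1 - ρ) * τ))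
  set E := Real.exp (m ^ 2 * τ / (1 - (1 + ρ) * τ))
  rw [hS2]
  field_simp
  ring

/-- In the case `μX/σX = μY/σY`: third-order recursion for the raw moments `μ'ₖ = E[Z̄ₙᵏ]` of
the mean `Z̄ₙ` of `n` independent `PN(μX, μY; σX², σY²; ρ)` random variables (with the
convention `μ'ₖ = 0` for `k < 0`). -/
theorem raw_moment_recursion_PNbar_equal_ratio
    (μX μY σX σY ρ : ℝ) (hσX : 0 < σX) (hσY : 0 < σY)
    (hρ₁ : -1 < ρ) (hρ₂ : ρ < 1) (heq : μX / σX = μY / σY)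
    (n : ℕ) (hn : 1 ≤ n)
    (s : ℝ) (hs : s = σX * σY / n)
    (M : ℤ → ℝ)
    (hMneg : ∀ k : ℤ, k < 0 → M k = 0)
    (hMnat : ∀ k : ℕ, M k = ∫ x, x ^ k ∂(PNbar n μX μY σX σY ρ)) :
    ∀ k : ℕ,
      M (k + 1)
        = (μX * μY + s * (ρ * n + (3 * ρ + 1) * k)) * M k
          - s * k * (μX * μY * (ρ - 1)
              + s * (n * (2 * ρ ^ 2 + ρ - 1) + (1 + ρ) * (3 * ρ - 1) * (k - 1))) * M (k - 1)
          - s ^ 3 * (1 + ρ) * (1 - ρ ^ 2) * k * (k - 1) * (k - 2 + n) * M (k - 2) := by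
  have hσX0 := hσX.ne'
  have hσY0 := hσY.ne'
  have hn0 : (n : ℝ) ≠ 0 := by positivity
  obtain ⟨m, rfl⟩ : ∃ m, μX = m * σX := ⟨μX / σX, by field_simp⟩
  obtain rfl : μY = m * σY := by
    rw [mul_div_cancel_right₀ _ hσX0] at heq
    rw [heq]
    field_simp
  have hc : m * σX * (m * σY) = n * s * m ^ 2 := by
    rw [hs]
    field_simp
  rw [hc]
  have hρ : 0 ≤ 1 - ρ ^ 2 := by nlinarith
  set P := PNbar n (m * σX) (m * σY) σX σY ρ
  have hpos : ∀ᶠ t in nhds (0 : ℝ), 0 < 1 - (1 + ρ) * (s * t) ∧ 0 < 1 + (1 - ρ) * (s * t) :=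
    (ContinuousAt.eventually_lt (by fun_prop) (by fun_prop) (by simp)).and
      (ContinuousAt.eventually_lt (by fun_prop) (by fun_prop) (by simp))
  have hmgf : ∀ t, 0 < 1 - (1 + ρ) * (s * t) ∧ 0 < 1 + (1 - ρ) * (s * t) →
      t ∈ integrableExpSet id P ∧ mgf id P t = equalRatioMGF m ρ (s * t) ^ n := by
    rintro t ⟨h1, h2⟩
    rw [hs] at h1 h2 ⊢
    exact integrable_and_mgf_PNbar n hρ (mul_pos h1 h2)
  have hmem : (0 : ℝ) ∈ interior (integrableExpSet id P) := by
    rw [mem_interior_iff_mem_nhds]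
    filter_upwards [hpos] with t ht using (hmgf t ht).1
  have hmom : ∀ k : ℕ, M k = iteratedDeriv k (mgf id P) 0 := by
    intro k
    rw [hMnat, iteratedDeriv_mgf_zero hmem]
    rfl
  have hode : ∀ᶠ t in nhds (0 : ℝ),
      (1 + ((1 - ρ) * s - 2 * ((1 + ρ) * s)) * t
          + (((1 + ρ) * s) ^ 2 - 2 * ((1 + ρ) * s) * ((1 - ρ) * s)) * t ^ 2
          + ((1 + ρ) * s) ^ 2 * ((1 - ρ) * s) * t ^ 3) * deriv (mgf id P) t
        = (n * s * (m ^ 2 + ρ)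
            + n * s * ((1 + ρ) * s * (1 - 2 * ρ) + m ^ 2 * ((1 - ρ) * s)) * t
            + -(n * ((1 + ρ) * s) ^ 2 * ((1 - ρ) * s)) * t ^ 2) * mgf id P t := by
    filter_upwards [hpos, hpos.eventually_nhds] with t ht htn
    have hev : mgf id P =ᶠ[nhds t] fun x => equalRatioMGF m ρ (s * x) ^ n := by
      filter_upwards [htn] with x hx using (hmgf x hx).2
    have hlin : HasDerivAt (fun x => s * x) s t := by
      simpa using (hasDerivAt_id t).const_mul s
    have hd := ((hasDerivAt_equalRatioMGF (m := m) ht.1 ht.2).comp t hlin).pow n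
    rw [hev.deriv_eq.trans hd.deriv, hev.eq_of_nhds]
    simp only [Function.comp_apply]
    obtain ⟨h1, h2⟩ := ht
    obtain ⟨j, rfl⟩ : ∃ j, n = j + 1 := ⟨n - 1, by omega⟩
    rw [Nat.add_sub_cancel, pow_succ]
    generalize equalRatioMGF m ρ (s * t) = f
    have h1' := h1.ne'
    have h2' := h2.ne'
    generalize hA : 1 - (1 + ρ) * (s * t) = A at *
    generalize hB : 1 + (1 - ρ) * (s * t) = B at *
    field_simp
    rw [← hA, ← hB]
    ring
  intro k
  have hrec := iteratedDeriv_recursion_of_ode (analyticAt_mgf hmem) _ _ _ _ _ _ hode k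
  simp only [← hmom] at hrec
  rcases k with _ | _ | k
  · norm_num at hrec ⊢
    linear_combination hrec
  · norm_num at hrec ⊢
    linear_combination hrec
  · have e1 : (((k + 2 : ℕ) : ℤ) - 1) = ((k + 1 : ℕ) : ℤ) := by push_cast; ring
    have e2 : (((k + 2 : ℕ) : ℤ) - 2) = ((k : ℕ) : ℤ) := by push_cast; ring
    have e3 : (((k + 2 : ℕ) : ℤ) + 1) = ((k + 2 + 1 : ℕ) : ℤ) := by push_cast; ring
    rw [show k + 1 + 1 = k + 2 from rfl, e1, e2, e3]
    rw [show k + 1 + 1 = k + 2 from rfl, show k + 2 - 1 = k + 1 from rfl,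
      show k + 2 - 2 = k from rfl] at hrec
    have ek : ((k + 2 : ℕ) : ℝ) = k + 2 := by push_cast; ring
    rw [ek] at hrec ⊢
    linear_combination hrec
end

section
/- Let n ≥ 1 and let Z̄_n be the mean of n independent PN(μ_X,μ_Y;σ_X²,σ_Y²;ρ) random variables, with mean m = E[Z̄_n] = μ_Xμ_Y + ρσ_Xσ_Y. Then the second, third and fourth central moments of Z̄_n are: E[(Z̄_n−m)²] = Var(Z̄_n) = (σ_X²σ_Y²/n)·(r_X² + r_Y² + 2ρ r_Xr_Y + ρ² + 1); E[(Z̄_n−m)³] = (2σ_X³σ_Y³/n²)·(3ρ(r_X²+r_Y²) + 3(ρ²+1)r_Xr_Y + ρ(ρ²+3)); E[(Z̄_n−m)⁴] = (3σ_X⁴σ_Y⁴/n³)·(n(r_X⁴+r_Y⁴) + 4ρn r_Xr_Y(r_X²+r_Y²) + 2n(2ρ²+1)r_X²r_Y² + 2(ρ²(n+6)+(n+2))(r_X²+r_Y²) + 4ρ(ρ²(n+2)+(n+6))r_Xr_Y + ρ⁴(n+2) + 2ρ²(n+6) + (n+2)). -/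
open MeasureTheory ProbabilityTheory

/-- Every power is integrable with respect to the standard normal law. -/
theorem integrable_pow_gaussianReal_zero_one (k : ℕ) :
    Integrable (fun x : ℝ => x ^ k) (gaussianReal 0 1) :=
  ((memLp_id_gaussianReal' (k : ENNReal) (ENNReal.natCast_ne_top k)).integrable_norm_pow').mono
    (by fun_prop) (by simp)

/-- The recursion `E[U ^ (k + 2)] = (k + 1) E[U ^ k]` for a standard normal variable `U`. -/
theorem integral_pow_add_two_gaussianReal_zero_one (k : ℕ) :
    ∫ x, x ^ (k + 2) ∂(gaussianReal 0 1) = (k + 1) * ∫ x, x ^ k ∂(gaussianReal 0 1) := by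
  have hpow (j : ℕ) : Integrable (fun x : ℝ => gaussianPDFReal 0 1 x * x ^ j) := by
    have h := integrable_pow_gaussianReal_zero_one j
    rw [gaussianReal_of_var_ne_zero 0 one_ne_zero,
      integrable_withDensity_iff_integrable_smul' (by fun_prop)
        (by simp [gaussianPDF])] at h
    simpa [gaussianPDF, gaussianPDFReal_nonneg] using h
  have hderiv (x : ℝ) : HasDerivAt (fun y : ℝ => gaussianPDFReal 0 1 y * y ^ (k + 1))
      ((k + 1) * (gaussianPDFReal 0 1 x * x ^ k) - gaussianPDFReal 0 1 x * x ^ (k + 2)) x := by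
    have hpdf : HasDerivAt (gaussianPDFReal 0 1) (-x * gaussianPDFReal 0 1 x) x := by
      have h : HasDerivAt (fun y : ℝ => -(y - 0) ^ 2 / (2 * ((1 : NNReal) : ℝ))) (-x) x := by
        have := ((((hasDerivAt_id x).sub_const 0).pow 2).neg).div_const (2 * ((1 : NNReal) : ℝ))
        convert! this using 1
        simp
        ring
      convert! (h.exp).const_mul (√(2 * Real.pi * ((1 : NNReal) : ℝ)))⁻¹ using 1
      simp only [gaussianPDFReal]
      ring
    convert! hpdf.mul (hasDerivAt_pow (k + 1) x) using 1
    push_cast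
    ring
  have hzero := integral_eq_zero_of_hasDerivAt_of_integrable hderiv
    (((hpow k).const_mul _).sub (hpow (k + 2))) (hpow (k + 1))
  rw [integral_sub ((hpow k).const_mul _) (hpow (k + 2)), integral_const_mul] at hzero
  simp only [integral_gaussianReal_eq_integral_smul one_ne_zero, smul_eq_mul]
  linarith

/-- The expectation of a polynomial of degree at most eight in a standard normal variable. -/
theorem integral_octic_gaussianReal_zero_one (c₀ c₁ c₂ c₃ c₄ c₅ c₆ c₇ c₈ : ℝ) :
    ∫ x, (c₀ + c₁ * x + c₂ * x ^ 2 + c₃ * x ^ 3 + c₄ * x ^ 4 + c₅ * x ^ 5 + c₆ * x ^ 6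
      + c₇ * x ^ 7 + c₈ * x ^ 8) ∂(gaussianReal 0 1)
      = c₀ + c₂ + 3 * c₄ + 15 * c₆ + 105 * c₈ := by
  have hrec := integral_pow_add_two_gaussianReal_zero_one
  have h₀ : ∫ x : ℝ, x ^ 0 ∂(gaussianReal 0 1) = 1 := by simp
  have h₁ : ∫ x : ℝ, x ^ 1 ∂(gaussianReal 0 1) = 0 := by simp [integral_id_gaussianReal]
  have h₂ := hrec 0
  have h₃ := hrec 1
  have h₄ := hrec 2
  have h₅ := hrec 3
  have h₆ := hrec 4
  have h₇ := hrec 5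
  have h₈ := hrec 6
  norm_num [h₀] at h₂
  rw [h₁] at h₃
  norm_num [h₂] at h₃ h₄
  norm_num [h₃] at h₅
  norm_num [h₄] at h₆
  norm_num [h₅] at h₇
  norm_num [h₆] at h₈
  have hi (c : ℝ) (k : ℕ) : Integrable (fun x : ℝ => c * x ^ k) (gaussianReal 0 1) :=
    (integrable_pow_gaussianReal_zero_one k).const_mul c
  have hsum : ∀ x : ℝ, c₀ + c₁ * x + c₂ * x ^ 2 + c₃ * x ^ 3 + c₄ * x ^ 4 + c₅ * x ^ 5
      + c₆ * x ^ 6 + c₇ * x ^ 7 + c₈ * x ^ 8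
      = ∑ i : Fin 9, (![c₀, c₁, c₂, c₃, c₄, c₅, c₆, c₇, c₈] i) * x ^ (i : ℕ) := by
    intro x
    simp [Fin.sum_univ_succ]
    ring
  simp only [hsum]
  rw [integral_finsetSum _ fun i _ => hi _ _]
  simp only [integral_const_mul]
  simp [Fin.sum_univ_succ, integral_id_gaussianReal, h₂, h₃, h₄, h₅, h₆, h₇, h₈]
  ring

/-- The first four moments of `A + B V` for a standard normal variable `V`. -/
theorem integral_affine_pow_gaussianReal_zero_one (A B : ℝ) :
    (∫ v, (A + B * v) ∂(gaussianReal 0 1) = A) ∧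
    (∫ v, (A + B * v) ^ 2 ∂(gaussianReal 0 1) = A ^ 2 + B ^ 2) ∧
    (∫ v, (A + B * v) ^ 3 ∂(gaussianReal 0 1) = A ^ 3 + 3 * A * B ^ 2) ∧
    (∫ v, (A + B * v) ^ 4 ∂(gaussianReal 0 1) = A ^ 4 + 6 * A ^ 2 * B ^ 2 + 3 * B ^ 4) := by
  refine ⟨?_, ?_, ?_, ?_⟩
  · convert! integral_octic_gaussianReal_zero_one A B 0 0 0 0 0 0 0 using 1
    · congr 1; ext v; ring
    · ring
  · convert! integral_octic_gaussianReal_zero_one (A ^ 2) (2 * A * B) (B ^ 2) 0 0 0 0 0 0 using 1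
    · congr 1; ext v; ring
    · ring
  · convert! integral_octic_gaussianReal_zero_one (A ^ 3) (3 * A ^ 2 * B) (3 * A * B ^ 2) (B ^ 3)
      0 0 0 0 0 using 1
    · congr 1; ext v; ring
    · ring
  · convert! integral_octic_gaussianReal_zero_one (A ^ 4) (4 * A ^ 3 * B) (6 * A ^ 2 * B ^ 2)
      (4 * A * B ^ 3) (B ^ 4) 0 0 0 0 using 1
    · congr 1; ext v; ring
    · ring

section Product

variable {α β : Type*} [MeasurableSpace α] [MeasurableSpace β] {ν : Measure α} {τ : Measure β}

theorem integrable_pow_of_memLp_four [IsFiniteMeasure ν] {f : α → ℝ} (hf : MemLp f 4 ν)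
    {k : ℕ} (hk : k ≤ 4) : Integrable (fun x => f x ^ k) ν := by
  have h : MemLp f (k : ENNReal) ν := hf.mono_exponent (by exact_mod_cast hk)
  exact h.integrable_norm_pow'.mono (hf.1.pow k) (by simp)

/-- Additivity of the second, third and fourth cumulants of independent centred variables. -/
theorem integral_add_pow_prod [IsProbabilityMeasure ν] [IsProbabilityMeasure τ]
    {f : α → ℝ} {g : β → ℝ} (hf : MemLp f 4 ν) (hg : MemLp g 4 τ)
    (hf₁ : ∫ x, f x ∂ν = 0) (hg₁ : ∫ y, g y ∂τ = 0) :
    (∫ p, (f p.1 + g p.2) ∂(ν.prod τ) = 0) ∧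
    (∫ p, (f p.1 + g p.2) ^ 2 ∂(ν.prod τ) = ∫ x, f x ^ 2 ∂ν + ∫ y, g y ^ 2 ∂τ) ∧
    (∫ p, (f p.1 + g p.2) ^ 3 ∂(ν.prod τ) = ∫ x, f x ^ 3 ∂ν + ∫ y, g y ^ 3 ∂τ) ∧
    (∫ p, (f p.1 + g p.2) ^ 4 ∂(ν.prod τ)
      = ∫ x, f x ^ 4 ∂ν + 6 * (∫ x, f x ^ 2 ∂ν) * (∫ y, g y ^ 2 ∂τ) + ∫ y, g y ^ 4 ∂τ) := by
  have hi (c : ℝ) {j k : ℕ} (hj : j ≤ 4) (hk : k ≤ 4) :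
      Integrable (fun p : α × β => c * (f p.1 ^ j * g p.2 ^ k)) (ν.prod τ) :=
    ((integrable_pow_of_memLp_four hf hj).mul_prod
      (integrable_pow_of_memLp_four hg hk)).const_mul c
  have key (k : ℕ) (hk : k ≤ 4) : ∫ p, (f p.1 + g p.2) ^ k ∂(ν.prod τ)
      = ∑ j ∈ Finset.range (k + 1),
        (k.choose j : ℝ) * ((∫ x, f x ^ j ∂ν) * ∫ y, g y ^ (k - j) ∂τ) := by
    have hexp (p : α × β) : (f p.1 + g p.2) ^ k
        = ∑ j ∈ Finset.range (k + 1), (k.choose j : ℝ) * (f p.1 ^ j * g p.2 ^ (k - j)) := by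
      rw [add_pow]
      exact Finset.sum_congr rfl fun j _ => by ring
    simp only [hexp]
    rw [integral_finsetSum _ fun j hj =>
      hi _ (by have := Finset.mem_range.mp hj; omega) (by omega)]
    refine Finset.sum_congr rfl fun j _ => ?_
    rw [integral_const_mul, integral_prod_mul (fun x => f x ^ j) (fun y => g y ^ (k - j))]
  have h₁ := key 1 (by norm_num)
  have h₂ := key 2 (by norm_num)
  have h₃ := key 3 (by norm_num)
  have h₄ := key 4 (by norm_num)
  simp [Finset.sum_range_succ, hf₁, hg₁, Nat.choose] at h₁ h₂ h₃ h₄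
  exact ⟨h₁, by linarith, by linarith, by linarith⟩

/-- Moments of a sum of `n` independent copies of a centred variable. -/
theorem integral_sum_pow_pi [IsProbabilityMeasure ν] {f : α → ℝ} (hf : MemLp f 4 ν)
    (hf₁ : ∫ x, f x ∂ν = 0) (n : ℕ) :
    MemLp (fun ω : Fin n → α => ∑ i, f (ω i)) 4 (Measure.pi fun _ => ν) ∧
    (∫ ω : Fin n → α, (∑ i, f (ω i)) ∂(Measure.pi fun _ => ν) = 0) ∧
    (∫ ω : Fin n → α, (∑ i, f (ω i)) ^ 2 ∂(Measure.pi fun _ => ν) = n * ∫ x, f x ^ 2 ∂ν) ∧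
    (∫ ω : Fin n → α, (∑ i, f (ω i)) ^ 3 ∂(Measure.pi fun _ => ν) = n * ∫ x, f x ^ 3 ∂ν) ∧
    (∫ ω : Fin n → α, (∑ i, f (ω i)) ^ 4 ∂(Measure.pi fun _ => ν)
      = n * ∫ x, f x ^ 4 ∂ν + 3 * n * (n - 1) * (∫ x, f x ^ 2 ∂ν) ^ 2) := by
  refine ⟨memLp_finsetSum _ fun i _ =>
    hf.comp_measurePreserving (measurePreserving_eval (fun _ => ν) i), ?_⟩
  induction n with
  | zero => simp
  | succ n ih =>
    obtain ⟨ih₁, ih₂, ih₃, ih₄⟩ := ih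
    have hsum : MemLp (fun ω : Fin n → α => ∑ i, f (ω i)) 4 (Measure.pi fun _ => ν) :=
      memLp_finsetSum _ fun i _ =>
        hf.comp_measurePreserving (measurePreserving_eval (fun _ => ν) i)
    have hsplit (k : ℕ) :
        ∫ ω : Fin (n + 1) → α, (∑ i, f (ω i)) ^ k ∂(Measure.pi fun _ => ν)
          = ∫ p : α × (Fin n → α), (f p.1 + ∑ i, f (p.2 i)) ^ k
            ∂(ν.prod (Measure.pi fun _ => ν)) := by
      rw [← (measurePreserving_piFinSuccAbove (fun _ : Fin (n + 1) => ν) 0).integral_comp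
        (MeasurableEquiv.measurableEmbedding _)]
      simp [Fin.sum_univ_succ, MeasurableEquiv.piFinSuccAbove, Fin.tail]
    obtain ⟨h₁, h₂, h₃, h₄⟩ := integral_add_pow_prod hf hsum hf₁ ih₁
    have hone := hsplit 1
    simp only [pow_one] at hone
    rw [hone, hsplit, hsplit, hsplit, h₁, h₂, h₃, h₄, ih₂, ih₃, ih₄]
    push_cast
    exact ⟨rfl, by ring, by ring, by ring⟩

end Product

/-- The product-normal variable as a function of two standard normal variables lies in `L⁴`. -/
theorem memLp_four_affine_mul_affine (a b c d e : ℝ) :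
    MemLp (fun p : ℝ × ℝ => (a + b * p.1) * (c + d * p.1 + e * p.2)) 4
      ((gaussianReal 0 1).prod (gaussianReal 0 1)) := by
  have h8 : MemLp (fun x : ℝ => x) 8 (gaussianReal 0 1) := memLp_id_gaussianReal' 8 (by simp)
  have hu := h8.comp_fst (gaussianReal 0 1)
  have hv := h8.comp_snd (gaussianReal 0 1)
  have : ENNReal.HolderTriple 8 8 4 := ⟨by
    rw [← two_mul, show (8 : ENNReal) = 2 * 4 by norm_num,
      ENNReal.mul_inv (by simp) (by simp), ← mul_assoc,
      ENNReal.mul_inv_cancel (by simp) (by simp), one_mul]⟩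
  exact MemLp.mul' (p := 8) (q := 8) (((memLp_const c).add (hu.const_mul d)).add (hv.const_mul e))
    ((memLp_const a).add (hu.const_mul b))

/-- Central moments of `(a + b U) (c + d U + e V)` for independent standard normal `U`, `V`. -/
theorem integral_affine_mul_affine_sub_pow (a b c d e : ℝ) :
    (∫ p : ℝ × ℝ, ((a + b * p.1) * (c + d * p.1 + e * p.2) - (a * c + b * d))
      ∂((gaussianReal 0 1).prod (gaussianReal 0 1)) = 0) ∧
    (∫ p : ℝ × ℝ, ((a + b * p.1) * (c + d * p.1 + e * p.2) - (a * c + b * d)) ^ 2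
      ∂((gaussianReal 0 1).prod (gaussianReal 0 1))
        = (a * d + b * c) ^ 2 + 2 * (b * d) ^ 2 + e ^ 2 * (a ^ 2 + b ^ 2)) ∧
    (∫ p : ℝ × ℝ, ((a + b * p.1) * (c + d * p.1 + e * p.2) - (a * c + b * d)) ^ 3
      ∂((gaussianReal 0 1).prod (gaussianReal 0 1))
        = 6 * (a * d + b * c) ^ 2 * (b * d) + 8 * (b * d) ^ 3
          + 6 * e ^ 2 * (b * (a * (a * d + b * c) + b * (b * d)))) ∧
    (∫ p : ℝ × ℝ, ((a + b * p.1) * (c + d * p.1 + e * p.2) - (a * c + b * d)) ^ 4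
      ∂((gaussianReal 0 1).prod (gaussianReal 0 1))
        = 3 * (a * d + b * c) ^ 4 + 60 * (a * d + b * c) ^ 2 * (b * d) ^ 2 + 60 * (b * d) ^ 4
          + 6 * e ^ 2 * (a ^ 2 * ((a * d + b * c) ^ 2 + 2 * (b * d) ^ 2)
            + 8 * a * b * (a * d + b * c) * (b * d)
            + b ^ 2 * (3 * (a * d + b * c) ^ 2 + 10 * (b * d) ^ 2))
          + 3 * e ^ 4 * (a ^ 4 + 6 * a ^ 2 * b ^ 2 + 3 * b ^ 4)) := by
  have hmem := (memLp_four_affine_mul_affine a b c d e).sub (memLp_const (a * c + b * d))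
  have hpow {k : ℕ} (hk : k ≤ 4) : Integrable (fun p : ℝ × ℝ =>
      ((a + b * p.1) * (c + d * p.1 + e * p.2) - (a * c + b * d)) ^ k)
      ((gaussianReal 0 1).prod (gaussianReal 0 1)) := integrable_pow_of_memLp_four hmem hk
  have haff (u v : ℝ) : (a + b * u) * (c + d * u + e * v) - (a * c + b * d)
      = (b * d * u ^ 2 + (a * d + b * c) * u - b * d) + e * (a + b * u) * v := by ring
  generalize hs : a * d + b * c = s at *
  generalize ht : b * d = t at *
  refine ⟨?_, ?_, ?_, ?_⟩
  · rw [integral_prod _ (by simpa using hpow (k := 1) (by norm_num))]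
    simp only [haff, (integral_affine_pow_gaussianReal_zero_one _ _).1]
    convert! integral_octic_gaussianReal_zero_one (-t) s t 0 0 0 0 0 0 using 1
    · congr 1; ext u; ring
    · ring
  · rw [integral_prod _ (hpow (by norm_num))]
    simp only [haff, (integral_affine_pow_gaussianReal_zero_one _ _).2.1]
    convert! integral_octic_gaussianReal_zero_one (t ^ 2 + e ^ 2 * a ^ 2)
      (-2 * s * t + 2 * e ^ 2 * a * b) (s ^ 2 - 2 * t ^ 2 + e ^ 2 * b ^ 2) (2 * s * t) (t ^ 2)
      0 0 0 0 using 1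
    · congr 1; ext u; ring
    · ring
  · rw [integral_prod _ (hpow (by norm_num))]
    simp only [haff, (integral_affine_pow_gaussianReal_zero_one _ _).2.2.1]
    convert! integral_octic_gaussianReal_zero_one (-t ^ 3 - 3 * e ^ 2 * t * a ^ 2)
      (3 * s * t ^ 2 + 3 * e ^ 2 * (a ^ 2 * s - 2 * a * b * t))
      (3 * t ^ 3 - 3 * s ^ 2 * t + 3 * e ^ 2 * (a ^ 2 * t + 2 * a * b * s - b ^ 2 * t))
      (s ^ 3 - 6 * s * t ^ 2 + 3 * e ^ 2 * (2 * a * b * t + b ^ 2 * s))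
      (3 * s ^ 2 * t - 3 * t ^ 3 + 3 * e ^ 2 * b ^ 2 * t) (3 * s * t ^ 2) (t ^ 3) 0 0 using 1
    · congr 1; ext u; ring
    · ring
  · rw [integral_prod _ (hpow (by norm_num))]
    simp only [haff, (integral_affine_pow_gaussianReal_zero_one _ _).2.2.2]
    have hoct (q₀ q₁ q₂ q₃ q₄ w₀ w₁ w₂ : ℝ) := integral_octic_gaussianReal_zero_one
      (q₀ ^ 2 + 6 * (q₀ * w₀) + 3 * w₀ ^ 2)
      (2 * q₀ * q₁ + 6 * (q₀ * w₁ + q₁ * w₀) + 6 * w₀ * w₁)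
      (2 * q₀ * q₂ + q₁ ^ 2 + 6 * (q₀ * w₂ + q₁ * w₁ + q₂ * w₀) + 3 * (2 * w₀ * w₂ + w₁ ^ 2))
      (2 * q₀ * q₃ + 2 * q₁ * q₂ + 6 * (q₁ * w₂ + q₂ * w₁ + q₃ * w₀) + 6 * w₁ * w₂)
      (2 * q₀ * q₄ + 2 * q₁ * q₃ + q₂ ^ 2 + 6 * (q₂ * w₂ + q₃ * w₁ + q₄ * w₀) + 3 * w₂ ^ 2)
      (2 * q₁ * q₄ + 2 * q₂ * q₃ + 6 * (q₃ * w₂ + q₄ * w₁))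
      (2 * q₂ * q₄ + q₃ ^ 2 + 6 * (q₄ * w₂)) (2 * q₃ * q₄) (q₄ ^ 2)
    convert! hoct (t ^ 2) (-2 * s * t) (s ^ 2 - 2 * t ^ 2) (2 * s * t) (t ^ 2)
      (e ^ 2 * a ^ 2) (2 * e ^ 2 * a * b) (e ^ 2 * b ^ 2) using 1
    · congr 1; ext u; ring
    · ring

/-- The second, third and fourth central moments of the mean `Z̄ₙ` of `n` independent
`PN(μX, μY; σX², σY²; ρ)` random variables, centred at `m = E[Z̄ₙ] = μXμY + ρσXσY`
(with `r_X = μX/σX`, `r_Y = μY/σY`). -/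
theorem central_moments_PNbar
    (μX μY σX σY ρ : ℝ) (hσX : 0 < σX) (hσY : 0 < σY)
    (hρ₁ : -1 < ρ) (hρ₂ : ρ < 1) (n : ℕ) (hn : 1 ≤ n)
    (rX rY : ℝ) (hrX : rX = μX / σX) (hrY : rY = μY / σY)
    (m : ℝ) (hm : m = μX * μY + ρ * σX * σY) :
    (∫ x, (x - m) ^ 2 ∂(PNbar n μX μY σX σY ρ)
      = σX ^ 2 * σY ^ 2 / n * (rX ^ 2 + rY ^ 2 + 2 * ρ * rX * rY + ρ ^ 2 + 1)) ∧
    (∫ x, (x - m) ^ 3 ∂(PNbar n μX μY σX σY ρ)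
      = 2 * σX ^ 3 * σY ^ 3 / n ^ 2
          * (3 * ρ * (rX ^ 2 + rY ^ 2) + 3 * (ρ ^ 2 + 1) * rX * rY + ρ * (ρ ^ 2 + 3))) ∧
    (∫ x, (x - m) ^ 4 ∂(PNbar n μX μY σX σY ρ)
      = 3 * σX ^ 4 * σY ^ 4 / n ^ 3
          * (n * (rX ^ 4 + rY ^ 4) + 4 * ρ * n * rX * rY * (rX ^ 2 + rY ^ 2)
              + 2 * n * (2 * ρ ^ 2 + 1) * rX ^ 2 * rY ^ 2
              + 2 * (ρ ^ 2 * (n + 6) + (n + 2)) * (rX ^ 2 + rY ^ 2)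
              + 4 * ρ * (ρ ^ 2 * (n + 2) + (n + 6)) * rX * rY
              + ρ ^ 4 * (n + 2) + 2 * ρ ^ 2 * (n + 6) + (n + 2))) := by
  have hn' : (n : ℝ) ≠ 0 := by exact_mod_cast (by omega : n ≠ 0)
  have hμX : μX = rX * σX := by rw [hrX]; field_simp
  have hμY : μY = rY * σY := by rw [hrY]; field_simp
  have he : Real.sqrt (1 - ρ ^ 2) ^ 2 = 1 - ρ ^ 2 := Real.sq_sqrt (by nlinarith)
  set s := Real.sqrt (1 - ρ ^ 2)
  have hm' : m = μX * μY + σX * (σY * ρ) := by rw [hm]; ring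
  have hmap : Measurable fun p : ℝ × ℝ =>
      (μX + σX * p.1) * (μY + σY * (ρ * p.1 + s * p.2)) := by fun_prop
  have hform (p : ℝ × ℝ) : (μX + σX * p.1) * (μY + σY * (ρ * p.1 + s * p.2))
      = (μX + σX * p.1) * (μY + (σY * ρ) * p.1 + (σY * s) * p.2) := by ring
  have hprob : IsProbabilityMeasure (PN μX μY σX σY ρ) :=
    Measure.isProbabilityMeasure_map hmap.aemeasurable
  have hmem : MemLp (fun z : ℝ => z - m) 4 (PN μX μY σX σY ρ) := by
    rw [PN, memLp_map_measure_iff (by fun_prop) hmap.aemeasurable]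
    refine MemLp.sub ?_ (memLp_const m)
    simpa only [hform] using memLp_four_affine_mul_affine μX σX μY (σY * ρ) (σY * s)
  have hpow (k : ℕ) : ∫ z, (z - m) ^ k ∂(PN μX μY σX σY ρ)
      = ∫ p : ℝ × ℝ, ((μX + σX * p.1) * (μY + (σY * ρ) * p.1 + (σY * s) * p.2)
        - (μX * μY + σX * (σY * ρ))) ^ k ∂((gaussianReal 0 1).prod (gaussianReal 0 1)) := by
    rw [PN, integral_map hmap.aemeasurable (by fun_prop)]
    simp only [hform, hm']
  obtain ⟨m₁, m₂, m₃, m₄⟩ :=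
    integral_affine_mul_affine_sub_pow μX σX μY (σY * ρ) (σY * s)
  have hcentred : ∫ z, (z - m) ∂(PN μX μY σX σY ρ) = 0 := by
    simpa [m₁] using hpow 1
  obtain ⟨-, -, h₂, h₃, h₄⟩ := integral_sum_pow_pi hmem hcentred n
  rw [hpow 2, m₂] at h₂ h₄
  rw [hpow 3, m₃] at h₃
  rw [hpow 4, m₄] at h₄
  have hbar (k : ℕ) : ∫ x, (x - m) ^ k ∂(PNbar n μX μY σX σY ρ)
      = (∫ ω : Fin n → ℝ, (∑ i, (ω i - m)) ^ k ∂(Measure.pi fun _ => PN μX μY σX σY ρ))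
        / n ^ k := by
    rw [PNbar, integral_map (by fun_prop) (by fun_prop), ← integral_div]
    congr 1
    ext ω
    rw [← div_pow]
    congr 1
    simp only [Finset.sum_sub_distrib, Finset.sum_const, Finset.card_univ, Fintype.card_fin,
      nsmul_eq_mul]
    field_simp
  have he₂ : (σY * s) ^ 2 = σY ^ 2 * (1 - ρ ^ 2) := by rw [mul_pow, he]
  have he₄ : (σY * s) ^ 4 = (σY ^ 2 * (1 - ρ ^ 2)) ^ 2 := by rw [← he₂]; ring
  rw [he₂] at h₂ h₃ h₄
  rw [he₄] at h₄
  rw [hbar, hbar, hbar, h₂, h₃, h₄, hμX, hμY]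
  refine ⟨?_, ?_, ?_⟩ <;> field_simp <;> ring
end
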